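/- For all γ > 0 and m > 0, the reciprocal inverse-Gaussian density integrates to one: ∫₀^∞ √(γ/(2πw)) · exp( −γ(1 − mw)²/(2m²w) ) dw = 1. -/

import Mathlib

open MeasureTheory Real Set

/-- The positive root of `x ^ 2 - y * x - c = 0`, that is, the inverse of `x ↦ x - c / x` on the
positive half-line. -/
noncomputable def posRoot (c y : ℝ) : ℝ := (y + √(y ^ 2 + 4 * c)) / 2

theorem posRoot_pos {c : ℝ} (hc : 0 < c) (y : ℝ) : 0 < posRoot c y := by
  have h : |y| < √(y ^ 2 + 4 * c) := by
    rw [← Real.sqrt_sq_eq_abs]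
    exact Real.sqrt_lt_sqrt (sq_nonneg y) (by linarith)
  have := neg_abs_le y
  unfold posRoot
  linarith

theorem posRoot_sq {c : ℝ} (hc : 0 < c) (y : ℝ) :
    posRoot c y ^ 2 = y * posRoot c y + c := by
  have h : √(y ^ 2 + 4 * c) ^ 2 = y ^ 2 + 4 * c := Real.sq_sqrt (by positivity)
  unfold posRoot
  linear_combination h / 4

theorem posRoot_sub_div {c x : ℝ} (hc : 0 < c) (hx : 0 < x) : posRoot c (x - c / x) = x := by
  have h : (x - c / x) ^ 2 + 4 * c = (x + c / x) ^ 2 := by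
    field_simp
    ring
  rw [posRoot, h, Real.sqrt_sq (by positivity)]
  ring

theorem injective_posRoot {c : ℝ} (hc : 0 < c) : Function.Injective (posRoot c) := by
  intro y z h
  have hy := posRoot_sq hc y
  rw [h, posRoot_sq hc z] at hy
  exact (mul_right_cancel₀ (posRoot_pos hc z).ne' (by linarith)).symm

theorem hasDerivAt_posRoot_sq {c : ℝ} (hc : 0 < c) (y : ℝ) :
    HasDerivAt (fun y => posRoot c y ^ 2)
      (posRoot c y * (1 + y / √(y ^ 2 + 4 * c))) y := by
  have hpos : 0 < y ^ 2 + 4 * c := by positivity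
  have h := (((hasDerivAt_id y).add
    ((((hasDerivAt_id y).pow 2).add_const (4 * c)).sqrt hpos.ne')).div_const 2).pow 2
  refine h.congr_deriv ?_
  have : √(y ^ 2 + 4 * c) ≠ 0 := (Real.sqrt_pos.mpr hpos).ne'
  simp [posRoot]
  field_simp

theorem range_posRoot_sq {c : ℝ} (hc : 0 < c) :
    (fun y => posRoot c y ^ 2) '' univ = Ioi 0 := by
  ext w
  simp only [image_univ, mem_range, mem_Ioi]
  constructor
  · rintro ⟨y, rfl⟩
    exact pow_pos (posRoot_pos hc y) 2
  · intro hw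
    exact ⟨√w - c / √w, by rw [posRoot_sub_div hc (Real.sqrt_pos.mpr hw), Real.sq_sqrt hw.le]⟩

theorem abs_div_sqrt_sq_add_le_one {c : ℝ} (hc : 0 < c) (y : ℝ) :
    |y / √(y ^ 2 + 4 * c)| ≤ 1 := by
  have hpos : 0 < y ^ 2 + 4 * c := by positivity
  rw [abs_div, abs_of_nonneg (Real.sqrt_nonneg _), div_le_one (Real.sqrt_pos.mpr hpos),
    ← Real.sqrt_sq_eq_abs]
  exact Real.sqrt_le_sqrt (by linarith)

theorem integral_eq_zero_of_odd {f : ℝ → ℝ} (hf : ∀ x, f (-x) = -f x) : ∫ x, f x = 0 := by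
  have h := integral_neg_eq_self f volume
  simp only [hf, integral_neg] at h
  linarith

theorem integral_one_add_mul_gaussian {b c : ℝ} (hb : 0 < b) (hc : 0 < c) :
    ∫ y : ℝ, (1 + y / √(y ^ 2 + 4 * c)) * exp (-b * y ^ 2) = √(π / b) := by
  have hg := integrable_exp_neg_mul_sq hb
  have ho : Integrable fun y : ℝ => y / √(y ^ 2 + 4 * c) * exp (-b * y ^ 2) :=
    hg.bdd_mul (c := 1) (Measurable.aestronglyMeasurable (by fun_prop))
      (.of_forall (abs_div_sqrt_sq_add_le_one hc))
  simp only [add_mul, one_mul]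
  rw [integral_add hg ho, integral_gaussian, integral_eq_zero_of_odd, add_zero]
  intro y
  simp [neg_div]

/-- The reciprocal inverse-Gaussian density integrates to one. -/
theorem rig_integral_eq_one (γ m : ℝ) (hγ : 0 < γ) (hm : 0 < m) :
    (∫ w in Set.Ioi (0 : ℝ),
        Real.sqrt (γ / (2 * Real.pi * w)) *
          Real.exp (-γ * (1 - m * w) ^ 2 / (2 * m ^ 2 * w))) = 1 := by
  have hc : 0 < 1 / m := by positivity
  have hinj : InjOn (fun y => posRoot (1 / m) y ^ 2) univ := fun y _ z _ h =>
    injective_posRoot hc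
      ((pow_left_inj₀ (posRoot_pos hc y).le (posRoot_pos hc z).le two_ne_zero).mp h)
  rw [← range_posRoot_sq hc, integral_image_eq_integral_abs_deriv_smul MeasurableSet.univ
    (fun y _ => (hasDerivAt_posRoot_sq hc y).hasDerivWithinAt) hinj, setIntegral_univ]
  have key : ∀ y : ℝ,
      |posRoot (1 / m) y * (1 + y / √(y ^ 2 + 4 * (1 / m)))| •
        (√(γ / (2 * π * posRoot (1 / m) y ^ 2)) *
          exp (-γ * (1 - m * posRoot (1 / m) y ^ 2) ^ 2 / (2 * m ^ 2 * posRoot (1 / m) y ^ 2))) =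
      √(γ / (2 * π)) *
        ((1 + y / √(y ^ 2 + 4 * (1 / m))) * exp (-(γ / 2) * y ^ 2)) := by
    intro y
    have hx := posRoot_pos hc y
    have hsq := posRoot_sq hc y
    have hr := neg_le_of_abs_le (abs_div_sqrt_sq_add_le_one hc y)
    set x := posRoot (1 / m) y
    have hexp : -γ * (1 - m * x ^ 2) ^ 2 / (2 * m ^ 2 * x ^ 2) = -(γ / 2) * y ^ 2 := by
      have h : 1 - m * x ^ 2 = -(m * y * x) := by
        rw [hsq]
        field_simp
        ring
      rw [h]
      field_simp
    have hsqrt : √(γ / (2 * π * x ^ 2)) = √(γ / (2 * π)) / x := by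
      rw [← div_div, Real.sqrt_div' _ (sq_nonneg x), Real.sqrt_sq hx.le]
    rw [hexp, hsqrt, abs_of_nonneg (mul_nonneg hx.le (by linarith)), smul_eq_mul]
    field_simp
  simp only [key]
  rw [integral_const_mul, integral_one_add_mul_gaussian (half_pos hγ) hc,
    ← Real.sqrt_mul (by positivity), Real.sqrt_eq_one]
  field_simp
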